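/- There is no nonzero polynomial p ∈ ℤ[X] such that the product q = p · (X⁶ − 4X³ + 1) has positive leading coefficient and every coefficient of q other than its leading coefficient is ≤ 0. Equivalently, no polynomial multiple of X⁶ − 4X³ + 1 in ℤ[X] can be written in the form X^h − ∑_{i=1}^{h} d_i X^{h−i} with all d_i nonnegative integers. -/

import Mathlib

open Polynomial

/-- If all non-leading coefficients of a real polynomial are nonpositive and its leading coefficient
is positive, then it has at most one positive root. -/
theorem eval_ne_zero_of_coeff_nonpos {q : ℝ[X]} (hlead : 0 < q.leadingCoeff)
    (hcoeff : ∀ i, i ≠ q.natDegree → q.coeff i ≤ 0) {a b : ℝ} (ha : 0 < a) (hab : a < b)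
    (hqa : q.eval a = 0) : q.eval b ≠ 0 := by
  intro hqb
  have hb : 0 < b := ha.trans hab
  rw [eval_eq_sum_range, Finset.sum_range_succ, coeff_natDegree] at hqa hqb
  have hneg : ∑ i ∈ Finset.range q.natDegree, q.coeff i * a ^ i < 0 := by
    have := mul_pos hlead (pow_pos ha q.natDegree)
    linarith
  obtain ⟨j, hj, hj0⟩ : ∃ j ∈ Finset.range q.natDegree, q.coeff j * a ^ j < 0 := by
    by_contra! h
    exact hneg.not_ge (Finset.sum_nonneg h)
  have hpow : ∀ i ∈ Finset.range q.natDegree,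
      b ^ i * a ^ q.natDegree < a ^ i * b ^ q.natDegree := by
    intro i hi
    have hi := Finset.mem_range.mp hi
    obtain ⟨k, hk⟩ := Nat.exists_eq_add_of_lt hi
    have hlt : a ^ (k + 1) < b ^ (k + 1) := pow_lt_pow_left₀ hab ha.le k.succ_ne_zero
    have := mul_lt_mul_of_pos_left hlt (mul_pos (pow_pos ha i) (pow_pos hb i))
    rw [hk, add_assoc, pow_add, pow_add b i]
    linarith
  have hsum : ∑ i ∈ Finset.range q.natDegree, q.coeff i * (a ^ i * b ^ q.natDegree) <
      ∑ i ∈ Finset.range q.natDegree, q.coeff i * (b ^ i * a ^ q.natDegree) := by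
    refine Finset.sum_lt_sum (fun i hi => ?_) ⟨j, hj, ?_⟩
    · exact mul_le_mul_of_nonpos_left (hpow i hi).le (hcoeff i (Finset.mem_range.mp hi).ne)
    · exact mul_lt_mul_of_neg_left (hpow j hj) (neg_of_mul_neg_left hj0 (pow_pos ha j).le)
  simp only [← mul_assoc, ← Finset.sum_mul] at hsum
  rw [eq_neg_of_add_eq_zero_left hqa, eq_neg_of_add_eq_zero_left hqb] at hsum
  linarith

theorem stmt17 :
    ¬ ∃ p : Polynomial ℤ, p ≠ 0 ∧
      (0 < (p * (X ^ 6 - 4 * X ^ 3 + 1)).leadingCoeff ∧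
        ∀ i : ℕ, i ≠ (p * (X ^ 6 - 4 * X ^ 3 + 1)).natDegree →
          (p * (X ^ 6 - 4 * X ^ 3 + 1)).coeff i ≤ 0) := by
  rintro ⟨p, -, hlead, hcoeff⟩
  have hinj : Function.Injective (Int.castRingHom ℝ) := Int.cast_injective
  have hroot : ∀ x : ℝ, x ^ 6 - 4 * x ^ 3 + 1 = 0 →
      ((p * (X ^ 6 - 4 * X ^ 3 + 1)).map (Int.castRingHom ℝ)).eval x = 0 := by
    intro x hx
    simp [hx]
  have hcube : ∀ y : ℝ, 0 < y → ∃ x : ℝ, 0 < x ∧ x ^ 3 = y := fun y hy =>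
    ⟨y ^ ((3 : ℕ) : ℝ)⁻¹, Real.rpow_pos_of_pos hy _, Real.rpow_inv_natCast_pow hy.le three_ne_zero⟩
  have hs : √3 ^ 2 = (3 : ℝ) := Real.sq_sqrt (by norm_num)
  have hs0 : 0 < √(3 : ℝ) := by positivity
  obtain ⟨a, ha, ha3⟩ := hcube (2 - √3) (by nlinarith)
  obtain ⟨b, hb, hb3⟩ := hcube (2 + √3) (by positivity)
  have hab : a < b := lt_of_pow_lt_pow_left₀ 3 hb.le (by linarith)
  refine eval_ne_zero_of_coeff_nonpos ?_ ?_ ha hab (hroot a ?_) (hroot b ?_)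
  · rw [leadingCoeff_map_of_injective hinj]
    exact Int.cast_pos.mpr hlead
  · intro i hi
    rw [natDegree_map_eq_of_injective hinj] at hi
    rw [coeff_map]
    exact Int.cast_nonpos.mpr (hcoeff i hi)
  · linear_combination (a ^ 3 - 2 - √3) * ha3 + hs
  · linear_combination (b ^ 3 - 2 + √3) * hb3 + hs
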